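/- Let Ψ(t) = (1, t₁, t₂, t₁², t₁t₂, t₂²)ᵀ for t = (t₁,t₂) ∈ [-1,1]², and M = ∫_{[-1,1]²} Ψ(t)Ψ(t)ᵀ dt. Then sup_{t ∈ [-1,1]²} Ψ(t)ᵀ M⁻¹ Ψ(t) = 13/2. -/

import Mathlib

open MeasureTheory Matrix Set

lemma mono_int (a b : ℕ) :
    ∫ t in (Icc (-1 : ℝ) 1) ×ˢ (Icc (-1 : ℝ) 1), (t : ℝ × ℝ).1 ^ a * t.2 ^ b =
      ((1 - (-1) ^ (a + 1)) / (a + 1)) * ((1 - (-1) ^ (b + 1)) / (b + 1)) := by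
  have h1 (n : ℕ) : ∫ x in Icc (-1 : ℝ) 1, x ^ n = (1 - (-1) ^ (n + 1)) / (n + 1) := by
    rw [integral_Icc_eq_integral_Ioc, ← intervalIntegral.integral_of_le (by norm_num),
      integral_pow]
    simp
  rw [Measure.volume_eq_prod, setIntegral_prod_mul (fun x : ℝ => x ^ a) (fun y : ℝ => y ^ b),
    h1, h1]

/-- For the two-dimensional quadratic basis `Ψ(t) = (1, t₁, t₂, t₁², t₁t₂, t₂²)` on the
square `[-1,1]²` with Gram matrix `M = ∫ ΨΨᵀ`, `sup Ψᵀ M⁻¹ Ψ = 13/2`, attained. -/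
theorem christoffel_quadratic_2d
    (Ψ : ℝ × ℝ → Fin 6 → ℝ)
    (hΨ : ∀ t : ℝ × ℝ, Ψ t = ![1, t.1, t.2, t.1 ^ 2, t.1 * t.2, t.2 ^ 2])
    (M : Matrix (Fin 6) (Fin 6) ℝ)
    (hM : M = Matrix.of fun i j =>
      ∫ t in (Icc (-1 : ℝ) 1) ×ˢ (Icc (-1 : ℝ) 1), Ψ t i * Ψ t j) :
    (∀ t ∈ (Icc (-1 : ℝ) 1) ×ˢ (Icc (-1 : ℝ) 1),
        Ψ t ⬝ᵥ (M⁻¹ *ᵥ Ψ t) ≤ 13 / 2) ∧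
      ∃ t ∈ (Icc (-1 : ℝ) 1) ×ˢ (Icc (-1 : ℝ) 1),
        Ψ t ⬝ᵥ (M⁻¹ *ᵥ Ψ t) = 13 / 2 := by
  have hM' : M = !![4, 0, 0, 4/3, 0, 4/3; 0, 4/3, 0, 0, 0, 0; 0, 0, 4/3, 0, 0, 0;
      4/3, 0, 0, 4/5, 0, 4/9; 0, 0, 0, 0, 4/9, 0; 4/3, 0, 0, 4/9, 0, 4/5] := by
    have key (i j : Fin 6) : M i j = ∫ t in (Icc (-1 : ℝ) 1) ×ˢ (Icc (-1 : ℝ) 1),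
        (t : ℝ × ℝ).1 ^ (![0, 1, 0, 2, 1, 0] i + ![0, 1, 0, 2, 1, 0] j : ℕ) *
          t.2 ^ (![0, 0, 1, 0, 1, 2] i + ![0, 0, 1, 0, 1, 2] j : ℕ) := by
      rw [hM, Matrix.of_apply]
      congr 1
      funext t
      rw [hΨ t]
      have h (k : Fin 6) : (![1, t.1, t.2, t.1 ^ 2, t.1 * t.2, t.2 ^ 2] : Fin 6 → ℝ) k =
          t.1 ^ (![0, 1, 0, 2, 1, 0] k : ℕ) * t.2 ^ (![0, 0, 1, 0, 1, 2] k : ℕ) := by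
        fin_cases k <;> simp
      rw [h i, h j]
      ring
    ext i j
    rw [key, mono_int]
    fin_cases i <;> fin_cases j <;> simp <;> norm_num
  have hinv : M⁻¹ = !![7/8, 0, 0, -15/16, 0, -15/16; 0, 3/4, 0, 0, 0, 0; 0, 0, 3/4, 0, 0, 0;
      -15/16, 0, 0, 45/16, 0, 0; 0, 0, 0, 0, 9/4, 0; -15/16, 0, 0, 0, 0, 45/16] := by
    apply Matrix.inv_eq_right_inv
    rw [hM']
    ext i j
    fin_cases i <;> fin_cases j <;>
      simp [Matrix.mul_apply, Fin.sum_univ_six, Matrix.one_apply] <;> norm_num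
  have hK (t : ℝ × ℝ) : Ψ t ⬝ᵥ (M⁻¹ *ᵥ Ψ t) = 7/8 + 3/4 * (t.1^2 + t.2^2)
      - 15/8 * (t.1^2 + t.2^2) + 45/16 * ((t.1^2)^2 + (t.2^2)^2) + 9/4 * (t.1^2 * t.2^2) := by
    rw [hinv, hΨ t]
    simp [Matrix.mulVec, dotProduct, Fin.sum_univ_six]
    ring
  constructor
  · rintro t ⟨⟨h1, h2⟩, h3, h4⟩
    rw [hK]
    have hx : t.1 ^ 2 ≤ 1 := by nlinarith
    have hy : t.2 ^ 2 ≤ 1 := by nlinarith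
    have hx0 := sq_nonneg t.1
    have hy0 := sq_nonneg t.2
    generalize t.1 ^ 2 = u at *
    generalize t.2 ^ 2 = v at *
    nlinarith [mul_nonneg hx0 (sub_nonneg.2 hx), mul_nonneg hy0 (sub_nonneg.2 hy),
      mul_nonneg hx0 (sub_nonneg.2 hy)]
  · refine ⟨(1, 1), by simp, ?_⟩
    rw [hK]
    norm_num
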